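/- arXiv:1605.03927 — 2 statements merged into one kernel-verified Lean document; each statement's English description precedes it below -/
import Mathlib

section
/- In the abstract Hilbert optimal-control setting, the error in the state satisfies ‖ȳ − y_T‖_V² ≤ (2 + 16/(ϑ²κ⁴)) η_st² + (8/(ϑ²κ²)) η_ad² + (4/κ + 16/(ϑ²κ⁵)) η_ct². -/
open MeasureTheory
open scoped InnerProductSpace

/-- The variational inequality characterizing the pointwise projection onto the box `[a, b]`. -/
theorem inner_clamp_sub_nonneg {Ω : Type*} [MeasurableSpace Ω] {μ : Measure Ω} {a b : ℝ}
    (hab : a ≤ b) {p w u : Lp ℝ 2 μ} (hp : p =ᵐ[μ] fun x => min b (max a (w x)))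
    (hu : ∀ᵐ x ∂μ, a ≤ u x ∧ u x ≤ b) : 0 ≤ ⟪p - w, u - p⟫_ℝ := by
  rw [L2.inner_def]
  apply integral_nonneg_of_ae
  filter_upwards [hp, hu, Lp.coeFn_sub p w, Lp.coeFn_sub u p] with x hpx hux hpw hup
  rw [hpw, hup]
  simp only [Pi.sub_apply, Pi.zero_apply, hpx, RCLike.inner_apply, conj_trivial]
  rcases le_total (w x) a with h | h
  · rw [max_eq_left h, min_eq_right hab]
    nlinarith
  · rw [max_eq_right h]
    rcases le_total b (w x) with h' | h'
    · rw [min_eq_left h']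
      nlinarith
    · rw [min_eq_right h']
      simp

/-- The clamped function takes values in `[a, b]` almost everywhere. -/
theorem ae_clamp_mem {Ω : Type*} [MeasurableSpace Ω] {μ : Measure Ω} {a b : ℝ}
    (hab : a ≤ b) {p w : Ω → ℝ} (hp : p =ᵐ[μ] fun x => min b (max a (w x))) :
    ∀ᵐ x ∂μ, a ≤ p x ∧ p x ≤ b := by
  filter_upwards [hp] with x hx
  rw [hx]
  exact ⟨le_min hab (le_max_left _ _), min_le_left _ _⟩

section

variable {V H : Type*} [NormedAddCommGroup V]

theorem sq_norm_sub_le_two_mul (x y z : V) :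
    ‖x - z‖ ^ 2 ≤ 2 * ‖x - y‖ ^ 2 + 2 * ‖y - z‖ ^ 2 := by
  have h := norm_sub_le_norm_sub_add_norm_sub x y z
  nlinarith [norm_nonneg (x - z), sq_nonneg (‖x - y‖ - ‖y - z‖)]

variable [NormedAddCommGroup H] {κ : ℝ}

theorem sq_norm_le_of_norm_le_inv_sqrt (hκ : 0 < κ) {x : H} {v : V}
    (h : ‖x‖ ≤ (Real.sqrt κ)⁻¹ * ‖v‖) : ‖x‖ ^ 2 ≤ κ⁻¹ * ‖v‖ ^ 2 := by
  calc ‖x‖ ^ 2 ≤ ((Real.sqrt κ)⁻¹ * ‖v‖) ^ 2 := by gcongr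
    _ = κ⁻¹ * ‖v‖ ^ 2 := by rw [mul_pow, inv_pow, Real.sq_sqrt hκ.le]

/-- Energy estimate for the solution of a coercive variational problem. -/
theorem sq_norm_le_of_sq_norm_eq_inner [InnerProductSpace ℝ H] (hκ : 0 < κ) {g x : H} {v : V}
    (hx : ‖x‖ ≤ (Real.sqrt κ)⁻¹ * ‖v‖) (h : ‖v‖ ^ 2 = ⟪g, x⟫_ℝ) :
    ‖v‖ ^ 2 ≤ κ⁻¹ * ‖g‖ ^ 2 := by
  have hκ' : 0 < κ⁻¹ := inv_pos.mpr hκ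
  have hsq := sq_norm_le_of_norm_le_inv_sqrt hκ hx
  have hcs : (‖v‖ ^ 2) ^ 2 ≤ ‖g‖ ^ 2 * ‖x‖ ^ 2 := by
    rw [← mul_pow]
    have h0 : 0 ≤ ‖v‖ ^ 2 := by positivity
    gcongr
    exact h.trans_le (real_inner_le_norm g x)
  rcases (sq_nonneg ‖v‖).eq_or_lt with h0 | h0
  · rw [← h0]
    positivity
  · refine le_of_mul_le_mul_right ?_ h0
    calc ‖v‖ ^ 2 * ‖v‖ ^ 2 = (‖v‖ ^ 2) ^ 2 := by ring
      _ ≤ ‖g‖ ^ 2 * ‖x‖ ^ 2 := hcs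
      _ ≤ ‖g‖ ^ 2 * (κ⁻¹ * ‖v‖ ^ 2) := by gcongr
      _ = κ⁻¹ * ‖g‖ ^ 2 * ‖v‖ ^ 2 := by ring

end

/-- In the abstract Hilbert optimal-control setting, the error in the state
satisfies `‖ȳ − y_T‖² ≤ (2 + 16/(ϑ²κ⁴)) η_st² + (8/(ϑ²κ²)) η_ad² + (4/κ + 16/(ϑ²κ⁵)) η_ct²`. -/
theorem state_error_bound
    {Ω : Type*} [MeasurableSpace Ω] (μ : Measure Ω) [IsFiniteMeasure μ]
    (a b : ℝ) (hab : a < b)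
    (Pi : Lp ℝ 2 μ → Lp ℝ 2 μ)
    (hPi : ∀ w : Lp ℝ 2 μ, (⇑(Pi w)) =ᵐ[μ] fun x => min b (max a (w x)))
    (κ ϑ : ℝ) (hκ : 0 < κ) (hϑ : 0 < ϑ)
    {V : Type*} [NormedAddCommGroup V] [InnerProductSpace ℝ V]
    (ι : V →ₗ[ℝ] Lp ℝ 2 μ)
    (hι : ∀ v : V, ‖ι v‖ ≤ (Real.sqrt κ)⁻¹ * ‖v‖)
    (B Bstar : V →ₗ[ℝ] V →ₗ[ℝ] ℝ)
    (hBstar : ∀ w v : V, Bstar w v = B v w)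
    (hBcoer : ∀ v : V, B v v = ‖v‖ ^ 2)
    (f yΩ : Lp ℝ 2 μ)
    (ybar pbar : V) (ubar : Lp ℝ 2 μ)
    (hubar_mem : ∀ᵐ x ∂μ, a ≤ ubar x ∧ ubar x ≤ b)
    (hstate : ∀ v : V, B ybar v = ⟪f + ubar, ι v⟫_ℝ)
    (hadjoint : ∀ w : V, Bstar pbar w = ⟪ι ybar - yΩ, ι w⟫_ℝ)
    (hVI : ∀ u : Lp ℝ 2 μ, (∀ᵐ x ∂μ, a ≤ u x ∧ u x ≤ b) →
        0 ≤ ⟪ι pbar + ϑ • ubar, u - ubar⟫_ℝ)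
    (yT pT : V) (uT : Lp ℝ 2 μ)
    (huT_mem : ∀ᵐ x ∂μ, a ≤ uT x ∧ uT x ≤ b)
    (utilde : Lp ℝ 2 μ) (hutilde : utilde = Pi (-ϑ⁻¹ • ι pT))
    (ηct : ℝ) (hηct : ηct = ‖uT - utilde‖)
    (yhat phat ytilde ptilde : V)
    (hyhat : ∀ v : V, B yhat v = ⟪f + uT, ι v⟫_ℝ)
    (hphat : ∀ w : V, Bstar phat w = ⟪ι yT - yΩ, ι w⟫_ℝ)
    (hytilde : ∀ v : V, B ytilde v = ⟪f + utilde, ι v⟫_ℝ)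
    (hptilde : ∀ w : V, Bstar ptilde w = ⟪ι ytilde - yΩ, ι w⟫_ℝ)
    (ηst ηad : ℝ) (hηst0 : 0 ≤ ηst) (hηad0 : 0 ≤ ηad)
    (hηst : ‖yhat - yT‖ ≤ ηst) (hηad : ‖phat - pT‖ ≤ ηad) :
    ‖ybar - yT‖ ^ 2 ≤ (2 + 16 / (ϑ ^ 2 * κ ^ 4)) * ηst ^ 2 + 8 / (ϑ ^ 2 * κ ^ 2) * ηad ^ 2
      + (4 / κ + 16 / (ϑ ^ 2 * κ ^ 5)) * ηct ^ 2 := by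
  have hclamp := hPi (-ϑ⁻¹ • ι pT)
  rw [← hutilde] at hclamp
  have energy : ∀ (y z : V) (g k : Lp ℝ 2 μ), (∀ v, B y v = ⟪g, ι v⟫_ℝ) →
      (∀ v, B z v = ⟪k, ι v⟫_ℝ) → ‖y - z‖ ^ 2 ≤ κ⁻¹ * ‖g - k‖ ^ 2 := fun y z g k hy hz =>
    sq_norm_le_of_sq_norm_eq_inner hκ (hι _) <| by
      rw [← hBcoer, map_sub B, LinearMap.sub_apply, hy, hz, inner_sub_left]
  have energy_adjoint : ‖ptilde - phat‖ ^ 2 ≤ κ⁻¹ * ‖ι (ytilde - yT)‖ ^ 2 :=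
    sq_norm_le_of_sq_norm_eq_inner hκ (hι _) <| by
      rw [← hBcoer, ← hBstar, map_sub Bstar, LinearMap.sub_apply, hptilde, hphat,
        ← inner_sub_left, sub_sub_sub_cancel_right, map_sub ι ytilde]
  have hcontrol : ϑ * ‖utilde - ubar‖ ^ 2 ≤ ⟪ι (ptilde - pT), utilde - ubar⟫_ℝ := by
    have hbar := hVI utilde (ae_clamp_mem hab.le hclamp)
    have htilde := mul_nonneg hϑ.le (inner_clamp_sub_nonneg hab.le hclamp hubar_mem)
    have hmono : ⟪ι (pbar - ptilde), utilde - ubar⟫_ℝ = -‖ι (ybar - ytilde)‖ ^ 2 := by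
      have h1 : B (ytilde - ybar) (pbar - ptilde) = ⟪utilde - ubar, ι (pbar - ptilde)⟫_ℝ := by
        rw [map_sub B, LinearMap.sub_apply, hytilde, hstate, ← inner_sub_left,
          add_sub_add_left_eq_sub]
      rw [real_inner_comm, ← h1, ← hBstar, map_sub Bstar, LinearMap.sub_apply, hadjoint, hptilde,
        ← inner_sub_left, sub_sub_sub_cancel_right, ← map_sub, ← neg_sub ybar ytilde, map_neg,
        inner_neg_right, real_inner_self_eq_norm_sq]
    have hsplit : ⟪ι pbar + ϑ • ubar, utilde - ubar⟫_ℝ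
        + ϑ * ⟪utilde - -ϑ⁻¹ • ι pT, ubar - utilde⟫_ℝ
        = ⟪ι (pbar - ptilde), utilde - ubar⟫_ℝ + ⟪ι (ptilde - pT), utilde - ubar⟫_ℝ
          - ϑ * ‖utilde - ubar‖ ^ 2 := by
      rw [← real_inner_self_eq_norm_sq, ← neg_sub utilde ubar, inner_neg_right]
      simp only [map_sub, inner_add_left, inner_sub_left, inner_smul_left, conj_trivial, neg_mul]
      field_simp
      ring
    nlinarith [sq_nonneg ‖ι (ybar - ytilde)‖]
  have hcontrol_sq : ϑ ^ 2 * ‖utilde - ubar‖ ^ 2 ≤ κ⁻¹ * ‖ptilde - pT‖ ^ 2 := by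
    refine le_trans ?_ (sq_norm_le_of_norm_le_inv_sqrt hκ (hι (ptilde - pT)))
    rw [← mul_pow]
    have h := hcontrol.trans (real_inner_le_norm _ _)
    rcases (norm_nonneg (utilde - ubar)).eq_or_lt with h0 | h0
    · rw [← h0]
      simp
    · gcongr
      exact le_of_mul_le_mul_right (by linarith) h0
  have hκ' : 0 < κ⁻¹ := inv_pos.mpr hκ
  have hst : ‖yhat - yT‖ ^ 2 ≤ ηst ^ 2 := by gcongr
  have had : ‖phat - pT‖ ^ 2 ≤ ηad ^ 2 := by gcongr
  have hy : ‖ytilde - yhat‖ ^ 2 ≤ κ⁻¹ * ηct ^ 2 := by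
    have h := energy _ _ _ _ hytilde hyhat
    rwa [add_sub_add_left_eq_sub, norm_sub_rev, norm_sub_rev utilde, ← hηct,
      norm_sub_rev yhat] at h
  have hyT : ‖ytilde - yT‖ ^ 2 ≤ 2 * (κ⁻¹ * ηct ^ 2) + 2 * ηst ^ 2 :=
    (sq_norm_sub_le_two_mul _ yhat _).trans (by gcongr)
  have hp : ‖ptilde - pT‖ ^ 2
      ≤ 2 * (κ⁻¹ * (κ⁻¹ * (2 * (κ⁻¹ * ηct ^ 2) + 2 * ηst ^ 2))) + 2 * ηad ^ 2 := by
    refine (sq_norm_sub_le_two_mul _ phat _).trans ?_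
    gcongr
    refine energy_adjoint.trans ?_
    gcongr
    refine (sq_norm_le_of_norm_le_inv_sqrt hκ (hι _)).trans ?_
    gcongr
  have hu : ‖utilde - ubar‖ ^ 2 ≤ (ϑ ^ 2)⁻¹ * (κ⁻¹ *
      (2 * (κ⁻¹ * (κ⁻¹ * (2 * (κ⁻¹ * ηct ^ 2) + 2 * ηst ^ 2))) + 2 * ηad ^ 2)) := by
    rw [le_inv_mul_iff₀ (by positivity)]
    refine hcontrol_sq.trans ?_
    gcongr
  have huT : ‖uT - ubar‖ ^ 2 ≤ 2 * ηct ^ 2 + 2 * ‖utilde - ubar‖ ^ 2 := by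
    rw [hηct]
    exact sq_norm_sub_le_two_mul _ _ _
  have hybar : ‖ybar - yhat‖ ^ 2 ≤ κ⁻¹ * ‖uT - ubar‖ ^ 2 := by
    have h := energy _ _ _ _ hstate hyhat
    rwa [add_sub_add_left_eq_sub, norm_sub_rev ubar] at h
  calc ‖ybar - yT‖ ^ 2 ≤ 2 * ‖ybar - yhat‖ ^ 2 + 2 * ‖yhat - yT‖ ^ 2 :=
        sq_norm_sub_le_two_mul _ _ _
    _ ≤ 2 * (κ⁻¹ * (2 * ηct ^ 2 + 2 * ((ϑ ^ 2)⁻¹ * (κ⁻¹ *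
          (2 * (κ⁻¹ * (κ⁻¹ * (2 * (κ⁻¹ * ηct ^ 2) + 2 * ηst ^ 2))) + 2 * ηad ^ 2)))))
          + 2 * ηst ^ 2 := by
        gcongr
        refine hybar.trans ?_
        gcongr
        refine huT.trans ?_
        gcongr
    _ = _ := by
        field_simp
        ring
end

section
/- In the abstract robust setting, let A_st, A_ad ≥ 0 satisfy ‖ŷ − y_T‖_R ≤ A_st and ‖p̂ − p_T‖_R ≤ A_ad. Then the error in the adjoint state satisfies ‖p̄ − p_T‖_R² ≤ (324/κ³)(2 + 648/(ϑ²κ⁴)) η_ct² + (2 + 1296/(ϑ²κ⁴)) A_ad² + (18/κ²)(2 + 1296/(ϑ²κ⁴)) A_st². -/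
open MeasureTheory
open scoped InnerProductSpace

/-- The variational inequality for the pointwise projection of `w` onto the box `[a, b]`. -/
lemma inner_sub_clamp_nonpos {Ω : Type*} [MeasurableSpace Ω] {μ : Measure Ω} {a b : ℝ}
    (hab : a ≤ b) {w q u : Lp ℝ 2 μ} (hq : q =ᵐ[μ] fun x => min b (max a (w x)))
    (hu : ∀ᵐ x ∂μ, a ≤ u x ∧ u x ≤ b) : ⟪w - q, u - q⟫_ℝ ≤ 0 := by
  rw [L2.inner_def]
  apply integral_nonpos_of_ae
  filter_upwards [hq, hu, Lp.coeFn_sub w q, Lp.coeFn_sub u q] with x hqx hux hwq huq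
  rw [hwq, huq]
  simp only [Pi.sub_apply, Pi.zero_apply, hqx, RCLike.inner_apply,
    conj_trivial]
  rcases le_total (w x) a with h | h
  · rw [max_eq_left h, min_eq_right hab]
    nlinarith [hux.1]
  · rw [max_eq_right h]
    rcases le_total (w x) b with h' | h'
    · simp [min_eq_right h']
    · rw [min_eq_left h']
      nlinarith [hux.2]

/-- An inf–sup stable form whose action on `w` is represented by `g` bounds `w` by `g`. -/
lemma infsup_stability {H V : Type*} [NormedAddCommGroup H] [InnerProductSpace ℝ H]
    [AddCommGroup V] [Module ℝ V] {N M : V → ℝ} {ι : V →ₗ[ℝ] H} {s : ℝ}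
    (hι : ∀ v, ‖ι v‖ ≤ s * N v) {B : V →ₗ[ℝ] V →ₗ[ℝ] ℝ}
    (hB : ∀ w : V, ∀ c : ℝ, (∀ v : V, B w v ≤ c * N v) → M w ≤ 3 * c)
    {w : V} {g : H} (hw : ∀ v, B w v = ⟪g, ι v⟫_ℝ) : M w ≤ 3 * (s * ‖g‖) := by
  refine hB w _ fun v => ?_
  calc B w v = ⟪g, ι v⟫_ℝ := hw v
    _ ≤ ‖g‖ * ‖ι v‖ := real_inner_le_norm _ _
    _ ≤ ‖g‖ * (s * N v) := by gcongr; exact hι v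
    _ = s * ‖g‖ * N v := by ring

/-- A weighted Cauchy–Schwarz inequality for three summands. -/
lemma one_add_mul_sum_sq_le (x X Y Z : ℝ) :
    ((1 + x) * (X + Y + Z)) ^ 2 ≤
      (2 + 16 * x ^ 2) * X ^ 2 + (4 + 32 * x ^ 2) * Y ^ 2 + (8 + 32 * x ^ 2) * Z ^ 2 := by
  have hA : 0 < 2 + 16 * x ^ 2 := by positivity
  have hB : 0 < 4 + 32 * x ^ 2 := by positivity
  have hC : 0 < 8 + 32 * x ^ 2 := by positivity
  have weights : (1 + x) ^ 2 *
      (1 / (2 + 16 * x ^ 2) + 1 / (4 + 32 * x ^ 2) + 1 / (8 + 32 * x ^ 2)) ≤ 1 := by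
    have hsum : 1 / (2 + 16 * x ^ 2) + 1 / (4 + 32 * x ^ 2) + 1 / (8 + 32 * x ^ 2)
        = (14 + 64 * x ^ 2) / ((2 + 16 * x ^ 2) * (8 + 32 * x ^ 2)) := by
      rw [show 4 + 32 * x ^ 2 = 2 * (2 + 16 * x ^ 2) by ring]
      field_simp
      ring
    rw [hsum, ← mul_div_assoc, div_le_one (by positivity)]
    nlinarith [sq_nonneg (1 - 7 * x + 3 * x ^ 2), sq_nonneg (x * (1 - 11 / 2 * x)),
      sq_nonneg (x ^ 2), sq_nonneg x]
  have cauchy : (X + Y + Z) ^ 2 ≤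
      (1 / (2 + 16 * x ^ 2) + 1 / (4 + 32 * x ^ 2) + 1 / (8 + 32 * x ^ 2)) *
        ((2 + 16 * x ^ 2) * X ^ 2 + (4 + 32 * x ^ 2) * Y ^ 2 + (8 + 32 * x ^ 2) * Z ^ 2) := by
    generalize 2 + 16 * x ^ 2 = p at *
    generalize 4 + 32 * x ^ 2 = q at *
    generalize 8 + 32 * x ^ 2 = r at *
    have gap : (1 / p + 1 / q + 1 / r) * (p * X ^ 2 + q * Y ^ 2 + r * Z ^ 2) - (X + Y + Z) ^ 2
        = (p * X - q * Y) ^ 2 / (p * q) + (p * X - r * Z) ^ 2 / (p * r)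
          + (q * Y - r * Z) ^ 2 / (q * r) := by
      field_simp
      ring
    have : 0 ≤ (p * X - q * Y) ^ 2 / (p * q) + (p * X - r * Z) ^ 2 / (p * r)
          + (q * Y - r * Z) ^ 2 / (q * r) := by positivity
    linarith
  calc ((1 + x) * (X + Y + Z)) ^ 2 = (1 + x) ^ 2 * (X + Y + Z) ^ 2 := by ring
    _ ≤ (1 + x) ^ 2 * (_ * _) := by gcongr
    _ = _ * _ := (mul_assoc _ _ _).symm
    _ ≤ 1 * _ := by gcongr
    _ = _ := one_mul _

/-- In the abstract robust setting, with `A_st, A_ad ≥ 0` such that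
`‖ŷ − y_T‖_R ≤ A_st` and `‖p̂ − p_T‖_R ≤ A_ad`, the error in the adjoint state satisfies
`‖p̄ − p_T‖_R² ≤ (324/κ³)(2 + 648/(ϑ²κ⁴)) η_ct² + (2 + 1296/(ϑ²κ⁴)) A_ad²
  + (18/κ²)(2 + 1296/(ϑ²κ⁴)) A_st²`. -/
theorem robust_adjoint_error_bound
    {Ω : Type*} [MeasurableSpace Ω] (μ : Measure Ω) [IsFiniteMeasure μ]
    (a b : ℝ) (hab : a < b)
    (Pi : Lp ℝ 2 μ → Lp ℝ 2 μ)
    (hPi : ∀ w : Lp ℝ 2 μ, (⇑(Pi w)) =ᵐ[μ] fun x => min b (max a (w x)))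
    (κ ϑ : ℝ) (hκ : 0 < κ) (hϑ : 0 < ϑ)
    {V : Type*} [AddCommGroup V] [Module ℝ V]
    (NOm NR : V → ℝ)
    (hNOm_add : ∀ v w : V, NOm (v + w) ≤ NOm v + NOm w)
    (hNOm_smul : ∀ (c : ℝ) (v : V), NOm (c • v) = |c| * NOm v)
    (hNOm_eq_zero : ∀ v : V, NOm v = 0 ↔ v = 0)
    (hNR_add : ∀ v w : V, NR (v + w) ≤ NR v + NR w)
    (hNR_smul : ∀ (c : ℝ) (v : V), NR (c • v) = |c| * NR v)
    (hNR_eq_zero : ∀ v : V, NR v = 0 ↔ v = 0)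
    (hOmR : ∀ v : V, NOm v ≤ NR v)
    (ι : V →ₗ[ℝ] Lp ℝ 2 μ)
    (hι : ∀ v : V, ‖ι v‖ ≤ (Real.sqrt κ)⁻¹ * NOm v)
    (B Bstar : V →ₗ[ℝ] V →ₗ[ℝ] ℝ)
    (hBstar : ∀ w v : V, Bstar w v = B v w)
    (hinfsupB : ∀ w : V, ∀ c : ℝ, (∀ v : V, B w v ≤ c * NOm v) → NR w ≤ 3 * c)
    (hinfsupBstar : ∀ w : V, ∀ c : ℝ, (∀ v : V, Bstar w v ≤ c * NOm v) → NR w ≤ 3 * c)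
    (f yΩ : Lp ℝ 2 μ)
    (ybar pbar : V) (ubar : Lp ℝ 2 μ)
    (hubar_mem : ∀ᵐ x ∂μ, a ≤ ubar x ∧ ubar x ≤ b)
    (hstate : ∀ v : V, B ybar v = ⟪f + ubar, ι v⟫_ℝ)
    (hadjoint : ∀ w : V, Bstar pbar w = ⟪ι ybar - yΩ, ι w⟫_ℝ)
    (hVI : ∀ u : Lp ℝ 2 μ, (∀ᵐ x ∂μ, a ≤ u x ∧ u x ≤ b) →
        0 ≤ ⟪ι pbar + ϑ • ubar, u - ubar⟫_ℝ)
    (yT pT : V) (uT : Lp ℝ 2 μ)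
    (huT_mem : ∀ᵐ x ∂μ, a ≤ uT x ∧ uT x ≤ b)
    (utilde : Lp ℝ 2 μ) (hutilde : utilde = Pi (-ϑ⁻¹ • ι pT))
    (ηct : ℝ) (hηct : ηct = ‖uT - utilde‖)
    (yhat phat ytilde ptilde : V)
    (hyhat : ∀ v : V, B yhat v = ⟪f + uT, ι v⟫_ℝ)
    (hphat : ∀ w : V, Bstar phat w = ⟪ι yT - yΩ, ι w⟫_ℝ)
    (hytilde : ∀ v : V, B ytilde v = ⟪f + utilde, ι v⟫_ℝ)
    (hptilde : ∀ w : V, Bstar ptilde w = ⟪ι ytilde - yΩ, ι w⟫_ℝ)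
    (Ast Aad : ℝ) (hAst0 : 0 ≤ Ast) (hAad0 : 0 ≤ Aad)
    (hAst : NR (yhat - yT) ≤ Ast) (hAad : NR (phat - pT) ≤ Aad) :
    NR (pbar - pT) ^ 2 ≤ 324 / κ ^ 3 * (2 + 648 / (ϑ ^ 2 * κ ^ 4)) * ηct ^ 2
      + (2 + 1296 / (ϑ ^ 2 * κ ^ 4)) * Aad ^ 2
      + 18 / κ ^ 2 * (2 + 1296 / (ϑ ^ 2 * κ ^ 4)) * Ast ^ 2 := by
  have NOm_nonneg : ∀ v, 0 ≤ NOm v := fun v => by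
    have hv := (norm_nonneg (ι v)).trans (hι v)
    exact nonneg_of_mul_nonneg_right hv (by positivity)
  have NR_tri : ∀ u v w, NR (u - w) ≤ NR (u - v) + NR (v - w) := fun u v w => by
    simpa using hNR_add (u - v) (v - w)
  have NR_symm : ∀ v w, NR (v - w) = NR (w - v) := fun v w => by
    simpa using hNR_smul (-1) (w - v)
  obtain ⟨s, hs⟩ : ∃ s, s = (Real.sqrt κ)⁻¹ := ⟨_, rfl⟩
  have hs0 : 0 < s := by rw [hs]; positivity
  have hs2 : s ^ 2 = κ⁻¹ := by rw [hs, inv_pow, Real.sq_sqrt hκ.le]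
  rw [← hs] at hι
  have hιR : ∀ v, ‖ι v‖ ≤ s * NR v := fun v =>
    (hι v).trans (mul_le_mul_of_nonneg_left (hOmR v) hs0.le)
  have state_stab : ∀ y₁ y₂ u₁ u₂, (∀ v, B y₁ v = ⟪f + u₁, ι v⟫_ℝ) →
      (∀ v, B y₂ v = ⟪f + u₂, ι v⟫_ℝ) → NR (y₁ - y₂) ≤ 3 * (s * ‖u₁ - u₂‖) := by
    intro y₁ y₂ u₁ u₂ h₁ h₂
    refine infsup_stability hι hinfsupB fun v => ?_
    rw [map_sub, LinearMap.sub_apply, h₁, h₂, ← inner_sub_left, add_sub_add_left_eq_sub]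
  have adjoint_stab : ∀ p₁ p₂ y₁ y₂, (∀ w, Bstar p₁ w = ⟪ι y₁ - yΩ, ι w⟫_ℝ) →
      (∀ w, Bstar p₂ w = ⟪ι y₂ - yΩ, ι w⟫_ℝ) →
      NR (p₁ - p₂) ≤ 3 * (s * (s * NR (y₁ - y₂))) := by
    intro p₁ p₂ y₁ y₂ h₁ h₂
    refine (infsup_stability hι hinfsupBstar (g := ι (y₁ - y₂)) fun w => ?_).trans ?_
    · rw [map_sub, LinearMap.sub_apply, h₁, h₂, ← inner_sub_left, sub_sub_sub_cancel_right,
        map_sub]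
    · gcongr
      exact hιR _
  have hproj : utilde =ᵐ[μ] fun x => min b (max a ((-ϑ⁻¹ • ι pT : Lp ℝ 2 μ) x)) :=
    hutilde ▸ hPi _
  have hutilde_mem : ∀ᵐ x ∂μ, a ≤ utilde x ∧ utilde x ≤ b := by
    filter_upwards [hproj] with x hx
    rw [hx]
    exact ⟨le_min hab.le (le_max_left _ _), min_le_left _ _⟩
  have hVI_tilde : 0 ≤ ⟪ι pT + ϑ • utilde, ubar - utilde⟫_ℝ := by
    have h := inner_sub_clamp_nonpos hab.le hproj hubar_mem
    have hscale : ι pT + ϑ • utilde = (-ϑ) • (-ϑ⁻¹ • ι pT - utilde) := by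
      rw [smul_sub, smul_smul, neg_mul_neg, mul_inv_cancel₀ hϑ.ne', one_smul, neg_smul,
        sub_neg_eq_add]
    rw [hscale, real_inner_smul_left]
    nlinarith
  have monotone_part : ⟪ι (ptilde - pbar), ubar - utilde⟫_ℝ ≤ 0 := by
    have hB : B (ybar - ytilde) (ptilde - pbar) = ⟪ι (ptilde - pbar), ubar - utilde⟫_ℝ := by
      rw [map_sub B, LinearMap.sub_apply, hstate, hytilde, ← inner_sub_left,
        add_sub_add_left_eq_sub, real_inner_comm]
    have hBs : Bstar (ptilde - pbar) (ybar - ytilde)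
        = -⟪ι (ybar - ytilde), ι (ybar - ytilde)⟫_ℝ := by
      rw [map_sub Bstar, LinearMap.sub_apply, hptilde, hadjoint, ← inner_sub_left,
        sub_sub_sub_cancel_right, ← map_sub, ← neg_sub ybar ytilde, map_neg, inner_neg_left]
    rw [← hB, ← hBstar, hBs]
    exact neg_nonpos.mpr real_inner_self_nonneg
  have control_energy : ϑ * ‖ubar - utilde‖ ^ 2 ≤ ⟪ι (pT - ptilde), ubar - utilde⟫_ℝ := by
    have h := hVI utilde hutilde_mem
    rw [← neg_sub ubar utilde, inner_neg_right] at h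
    rw [← real_inner_self_eq_norm_sq]
    have hsplit : ⟪ι (pT - ptilde), ubar - utilde⟫_ℝ + ⟪ι (ptilde - pbar), ubar - utilde⟫_ℝ
        - ϑ * ⟪ubar - utilde, ubar - utilde⟫_ℝ
        = ⟪ι pT + ϑ • utilde, ubar - utilde⟫_ℝ - ⟪ι pbar + ϑ • ubar, ubar - utilde⟫_ℝ := by
      rw [← real_inner_smul_left, ← inner_add_left, ← inner_sub_left, ← inner_sub_left]
      congr 1
      simp only [map_sub, smul_sub]
      abel
    linarith
  have control_bound : ‖ubar - utilde‖ ≤ ϑ⁻¹ * (s * NR (ptilde - pT)) := by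
    rw [inv_mul_eq_div, le_div_iff₀ hϑ, NR_symm]
    rcases (norm_nonneg (ubar - utilde)).eq_or_lt with h | h
    · rw [← h, zero_mul]
      exact (norm_nonneg _).trans (hιR _)
    · have hcs := real_inner_le_norm (ι (pT - ptilde)) (ubar - utilde)
      have hle := mul_le_mul_of_nonneg_right (hιR (pT - ptilde)) h.le
      refine le_of_mul_le_mul_right ?_ h
      linarith
  have control_tri : ‖ubar - uT‖ ≤ ‖ubar - utilde‖ + ηct := by
    rw [hηct, norm_sub_rev uT utilde]
    exact norm_sub_le_norm_sub_add_norm_sub _ _ _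
  have ytilde_bound : NR (ytilde - yT) ≤ 3 * (s * ηct) + Ast := by
    have h := state_stab ytilde yhat utilde uT hytilde hyhat
    rw [norm_sub_rev, ← hηct] at h
    linarith [NR_tri ytilde yhat yT]
  have ptilde_bound : NR (ptilde - pT) ≤ 3 * (s * (s * (3 * (s * ηct) + Ast))) + Aad := by
    have h : NR (ptilde - phat) ≤ 3 * (s * (s * (3 * (s * ηct) + Ast))) :=
      (adjoint_stab ptilde phat ytilde yT hptilde hphat).trans (by gcongr)
    linarith [NR_tri ptilde phat pT]
  have ubar_bound : ‖ubar - uT‖ ≤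
      ϑ⁻¹ * (s * (3 * (s * (s * (3 * (s * ηct) + Ast))) + Aad)) + ηct :=
    control_tri.trans (add_le_add_left (control_bound.trans (by gcongr)) _)
  have ybar_bound : NR (ybar - yT) ≤
      3 * (s * (ϑ⁻¹ * (s * (3 * (s * (s * (3 * (s * ηct) + Ast))) + Aad)) + ηct)) + Ast :=
    (NR_tri ybar yhat yT).trans
      (add_le_add ((state_stab ybar yhat ubar uT hstate hyhat).trans (by gcongr)) hAst)
  have pbar_bound : NR (pbar - pT) ≤
      (1 + 9 * ϑ⁻¹ * s ^ 4) * (Aad + 3 * s ^ 2 * Ast + 9 * s ^ 3 * ηct) :=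
    calc NR (pbar - pT) ≤ 3 * (s * (s * NR (ybar - yT))) + Aad :=
          (NR_tri pbar phat pT).trans
            (add_le_add (adjoint_stab pbar phat ybar yT hadjoint hphat) hAad)
      _ ≤ 3 * (s * (s * (3 * (s * (ϑ⁻¹ * (s * (3 * (s * (s * (3 * (s * ηct) + Ast))) + Aad))
            + ηct)) + Ast))) + Aad := by gcongr
      _ = _ := by ring
  have hNR0 : 0 ≤ NR (pbar - pT) := (NOm_nonneg _).trans (hOmR _)
  refine ((pow_le_pow_left₀ hNR0 pbar_bound 2).trans
    (one_add_mul_sum_sq_le _ _ _ _)).trans_eq ?_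
  have hκ2 : κ = (s ^ 2)⁻¹ := by rw [hs2, inv_inv]
  rw [hκ2]
  field_simp
  ring
end
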